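/- Let P ∈ ℂ[x] be nonzero with P(it) real and ≥ 0 for every t ∈ ℝ, and let α ∈ (−1, 0] be a real root of P. Let R ∈ ℂ[x] be nonzero, set F(x) = −Re₀(R̄(1−x)·R(x−1)·P(x−1)), and let S ∈ ℂ[x] satisfy S(x+1) − S(x−1) = F(x) and S̄(−x) = −S(x) (such an S exists and is unique up to adding a purely imaginary constant). Then S(−α) − S(α) is a positive real number if α ∈ (−1, 0), and S'(0) is a positive real number if α = 0. -/

import Mathlib

open Polynomial
open scoped Classical

noncomputable section

/-- `pconj F` is the polynomial `F̄(−x)`, where `F̄` has the conjugate coefficients. -/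
def pconj (F : ℂ[X]) : ℂ[X] := (F.map (starRingEnd ℂ)).comp (-X)

/-- `re0 F` is the polynomial `(F(x) + F̄(−x))/2`; it is the unique polynomial agreeing with
`Re (F(x))` on the imaginary axis. -/
def re0 (F : ℂ[X]) : ℂ[X] := (2⁻¹ : ℂ) • (F + pconj F)

/-- A polynomial multiple of the reciprocal of `cos (πz/2)`, free of poles in `|re z| < 3`. -/
def secKernel (z : ℂ) : ℂ := Complex.Gamma ((3 + z) / 2) * Complex.Gamma ((3 - z) / 2)

theorem differentiableAt_secKernel {z : ℂ} (hz : |z.re| < 3) :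
    DifferentiableAt ℂ secKernel z := by
  have key : ∀ w : ℂ, 0 < w.re → DifferentiableAt ℂ Complex.Gamma w := by
    intro w hw
    refine Complex.differentiableAt_Gamma w fun m h => ?_
    rw [h] at hw
    simp only [Complex.neg_re, Complex.natCast_re] at hw
    linarith [(Nat.cast_nonneg m : (0 : ℝ) ≤ m)]
  rw [abs_lt] at hz
  have h1 : 0 < ((3 + z) / 2).re := by simp; linarith
  have h2 : 0 < ((3 - z) / 2).re := by simp; linarith
  exact ((key _ h1).fun_comp' z (f := fun z => (3 + z) / 2) (by fun_prop)).mul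
    ((key _ h2).fun_comp' z (f := fun z => (3 - z) / 2) (by fun_prop))

theorem exp_sub_exp_le_norm_cos (z : ℂ) :
    (Real.exp |z.im| - Real.exp (-|z.im|)) / 2 ≤ ‖Complex.cos z‖ := by
  have h1 : ‖Complex.exp (z * Complex.I)‖ = Real.exp (-z.im) := by
    rw [Complex.norm_exp]; simp
  have h2 : ‖Complex.exp (-z * Complex.I)‖ = Real.exp z.im := by
    rw [Complex.norm_exp]; simp
  have h3 : ‖Complex.cos z‖ = ‖Complex.exp (z * Complex.I) + Complex.exp (-z * Complex.I)‖ / 2 := by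
    rw [Complex.cos, norm_div]; simp
  rw [h3]
  rcases abs_cases z.im with ⟨h, -⟩ | ⟨h, -⟩ <;> rw [h]
  · have := norm_sub_le_norm_add (Complex.exp (-z * Complex.I)) (Complex.exp (z * Complex.I))
    rw [h1, h2, add_comm] at this
    linarith
  · have := norm_sub_le_norm_add (Complex.exp (z * Complex.I)) (Complex.exp (-z * Complex.I))
    rw [h1, h2] at this
    rw [neg_neg]
    linarith

theorem cos_pi_mul_div_two_ne_zero {z : ℂ} (hz : z.im ≠ 0) : Complex.cos (Real.pi * z / 2) ≠ 0 := by
  have h := exp_sub_exp_le_norm_cos (Real.pi * z / 2)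
  have him : (Real.pi * z / 2 : ℂ).im = Real.pi * z.im / 2 := by simp
  have hpos : 0 < |(Real.pi * z / 2 : ℂ).im| := by
    rw [him]; have := Real.pi_pos; positivity
  have := Real.exp_lt_exp.2 (by linarith : -|(Real.pi * z / 2 : ℂ).im| < |(Real.pi * z / 2 : ℂ).im|)
  exact norm_pos_iff.1 (by linarith)

theorem secKernel_mul_cos {z : ℂ} (hz : z.im ≠ 0) :
    secKernel z * Complex.cos (Real.pi * z / 2) = Real.pi / 4 * (1 - z ^ 2) := by
  have hc := cos_pi_mul_div_two_ne_zero hz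
  have h1 : (1 + z) / 2 ≠ 0 := fun h => hz (by simpa using congrArg Complex.im h)
  have h2 : (1 - z) / 2 ≠ 0 := fun h => hz (by simpa using congrArg Complex.im h)
  have e1 := Complex.Gamma_add_one _ h1
  have e2 := Complex.Gamma_add_one _ h2
  have e3 := Complex.Gamma_mul_Gamma_one_sub ((1 + z) / 2)
  have hs : Complex.sin (Real.pi * ((1 + z) / 2)) = Complex.cos (Real.pi * z / 2) := by
    rw [← Complex.sin_add_pi_div_two]; congr 1; ring
  rw [hs, show 1 - (1 + z) / 2 = (1 - z) / 2 by ring, eq_div_iff hc] at e3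
  rw [secKernel, show (3 + z) / 2 = (1 + z) / 2 + 1 by ring,
    show (3 - z) / 2 = (1 - z) / 2 + 1 by ring, e1, e2]
  linear_combination ((1 + z) / 2) * ((1 - z) / 2) * e3

theorem exp_abs_le_norm_cos {z : ℂ} (hz : 1 ≤ |z.im|) :
    Real.exp (3 / 2 * |z.im|) / 4 ≤ ‖Complex.cos (Real.pi * z / 2)‖ := by
  have h := exp_sub_exp_le_norm_cos (Real.pi * z / 2)
  have him : |(Real.pi * z / 2 : ℂ).im| = Real.pi * |z.im| / 2 := by
    simp [abs_mul, abs_div, abs_of_pos Real.pi_pos]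
  rw [him] at h
  have h1 : Real.exp (3 / 2 * |z.im|) ≤ Real.exp (Real.pi * |z.im| / 2) := by
    apply Real.exp_le_exp.2; nlinarith [Real.pi_gt_three]
  have h2 : 2 ≤ Real.exp (3 / 2 * |z.im|) := by
    have := Real.add_one_le_exp (3 / 2 * |z.im|); linarith
  have h3 : Real.exp (-(Real.pi * |z.im| / 2)) ≤ 1 := by
    apply Real.exp_le_one_iff.2; have := Real.pi_pos; simp; positivity
  linarith

theorem Polynomial.exists_norm_eval_le_mul_exp (Q : ℂ[X]) :
    ∃ C : ℝ, 0 ≤ C ∧ ∀ z : ℂ, ‖Q.eval z‖ ≤ C * Real.exp ‖z‖ := by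
  induction Q using Polynomial.induction_on' with
  | add p q hp hq =>
    obtain ⟨A, hA, hA'⟩ := hp
    obtain ⟨B, hB, hB'⟩ := hq
    refine ⟨A + B, by positivity, fun z => ?_⟩
    rw [eval_add, add_mul]
    exact (norm_add_le _ _).trans (add_le_add (hA' z) (hB' z))
  | monomial n c =>
    refine ⟨‖c‖ * n.factorial, by positivity, fun z => ?_⟩
    rw [eval_monomial, norm_mul, norm_pow, mul_assoc]
    have h := Real.pow_div_factorial_le_exp ‖z‖ (norm_nonneg z) n
    rw [div_le_iff₀ (by positivity)] at h
    gcongr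
    linarith

/-- The integrand whose boundary values on the strip `|re z| ≤ 1` are compared. -/
def stripKernel (K : ℂ[X]) (a : ℝ) (z : ℂ) : ℂ :=
  K.eval z * (secKernel (z + a) * secKernel (z - a))

theorem differentiableAt_stripKernel (K : ℂ[X]) {a : ℝ} (ha : |a| < 1) {z : ℂ} (hz : |z.re| ≤ 1) :
    DifferentiableAt ℂ (stripKernel K a) z := by
  rw [abs_lt] at ha
  rw [abs_le] at hz
  have h1 : |(z + a).re| < 3 := by rw [abs_lt]; simp; constructor <;> linarith
  have h2 : |(z - a).re| < 3 := by rw [abs_lt]; simp; constructor <;> linarith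
  exact K.differentiableAt.mul
    (((differentiableAt_secKernel h1).fun_comp' z (f := fun z => z + (a : ℂ)) (by fun_prop)).mul
    ((differentiableAt_secKernel h2).fun_comp' z (f := fun z => z - (a : ℂ)) (by fun_prop)))

theorem stripKernel_mul_cos (K : ℂ[X]) (a : ℝ) {z : ℂ} (hz : z.im ≠ 0) :
    stripKernel K a z * (Complex.cos (Real.pi * (z + a) / 2) * Complex.cos (Real.pi * (z - a) / 2))
      = Real.pi ^ 2 / 16 * (K.eval z * ((1 - (z + a) ^ 2) * (1 - (z - a) ^ 2))) := by
  have h1 := secKernel_mul_cos (z := z + a) (by simpa using hz)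
  have h2 := secKernel_mul_cos (z := z - a) (by simpa using hz)
  calc _ = K.eval z * (secKernel (z + a) * Complex.cos (Real.pi * (z + a) / 2)) *
        (secKernel (z - a) * Complex.cos (Real.pi * (z - a) / 2)) := by
        rw [stripKernel]; ring
    _ = _ := by rw [h1, h2]; ring

theorem exists_norm_stripKernel_le (K : ℂ[X]) {a : ℝ} (ha : |a| < 1) :
    ∃ M : ℝ, ∀ z : ℂ, |z.re| ≤ 1 → ‖stripKernel K a z‖ ≤ M * (1 + z.im ^ 2)⁻¹ := by
  obtain ⟨C, hC, hQ⟩ := (K * ((1 - (X + C (a : ℂ)) ^ 2) *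
    (1 - (X - C (a : ℂ)) ^ 2))).exists_norm_eval_le_mul_exp
  have hcomp : IsCompact (Set.Icc (-1 : ℝ) 1 ×ℂ Set.Icc (-1 : ℝ) 1) :=
    isCompact_Icc.reProdIm isCompact_Icc
  obtain ⟨B, hB⟩ := hcomp.exists_bound_of_continuousOn (f := stripKernel K a) fun z hz =>
    (differentiableAt_stripKernel K ha
      (abs_le.2 (Complex.mem_reProdIm.1 hz).1)).continuousAt.continuousWithinAt
  refine ⟨max (2 * B) (Real.pi ^ 2 * C * Real.exp 1), fun z hz => ?_⟩
  have hden : 0 < 1 + z.im ^ 2 := by positivity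
  rw [← div_eq_mul_inv, le_div_iff₀ hden]
  rcases le_total |z.im| 1 with h | h
  · refine le_trans ?_ (le_max_left _ _)
    have h1 := hB z (Complex.mem_reProdIm.2 ⟨abs_le.1 hz, abs_le.1 h⟩)
    have h2 : z.im ^ 2 ≤ 1 := by rw [← sq_abs]; exact pow_le_one₀ (abs_nonneg _) h
    nlinarith [norm_nonneg (stripKernel K a z)]
  · refine le_trans ?_ (le_max_right _ _)
    have hne : z.im ≠ 0 := fun h0 => by simp [h0] at h; linarith
    have h0 := congrArg norm (stripKernel_mul_cos K a hne)
    have h1 := exp_abs_le_norm_cos (z := z + a) (by simpa using h)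
    have h2 := exp_abs_le_norm_cos (z := z - a) (by simpa using h)
    have h3 := hQ z
    simp only [Complex.add_im, Complex.sub_im, Complex.ofReal_im, add_zero, sub_zero] at h1 h2
    rw [norm_mul, norm_mul, norm_mul] at h0
    have hn : ‖(Real.pi ^ 2 / 16 : ℂ)‖ = Real.pi ^ 2 / 16 := by
      simp [abs_of_pos Real.pi_pos]
    simp only [eval_mul, eval_sub, eval_one, eval_pow, eval_add, eval_X, eval_C] at h3
    rw [hn] at h0
    set E := Real.exp |z.im| with hE
    have hEz : Real.exp ‖z‖ ≤ Real.exp 1 * E := by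
      rw [hE, ← Real.exp_add]
      apply Real.exp_le_exp.2
      linarith [Complex.norm_le_abs_re_add_abs_im z]
    have hE3 : Real.exp (3 / 2 * |z.im|) * Real.exp (3 / 2 * |z.im|) = E * E ^ 2 := by
      rw [hE, ← Real.exp_nat_mul, ← Real.exp_add, ← Real.exp_add]; congr 1; push_cast; ring
    have hE2 : 1 + z.im ^ 2 ≤ E ^ 2 := by
      have := Real.add_one_le_exp |z.im|
      have h4 := abs_nonneg z.im
      rw [← sq_abs z.im]
      nlinarith
    have hEpos : 0 < E := Real.exp_pos _
    have h5 : ‖stripKernel K a z‖ * (E * E ^ 2 / 16) ≤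
        Real.pi ^ 2 / 16 * (C * (Real.exp 1 * E)) := by
      calc _ = ‖stripKernel K a z‖ * (Real.exp (3 / 2 * |z.im|) / 4 *
            (Real.exp (3 / 2 * |z.im|) / 4)) := by rw [← hE3]; ring
        _ ≤ _ := by gcongr
        _ = _ := h0
        _ ≤ _ := by
          gcongr
          exact h3.trans (by gcongr)
    have h6 : ‖stripKernel K a z‖ * E ^ 2 * E ≤ Real.pi ^ 2 * C * Real.exp 1 * E := by
      linarith
    exact (by gcongr : _ ≤ ‖stripKernel K a z‖ * E ^ 2).trans (le_of_mul_le_mul_right h6 hEpos)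

open MeasureTheory Filter Topology in
theorem integral_eq_of_differentiableAt_strip {f : ℂ → ℂ} {M : ℝ}
    (hd : ∀ z : ℂ, |z.re| ≤ 1 → DifferentiableAt ℂ f z)
    (hM : ∀ z : ℂ, |z.re| ≤ 1 → ‖f z‖ ≤ M * (1 + z.im ^ 2)⁻¹) :
    Integrable (fun t : ℝ => f (1 + t * Complex.I) - f (-1 + t * Complex.I)) ∧
      ∫ t : ℝ, (f (1 + t * Complex.I) - f (-1 + t * Complex.I)) = 0 := by
  have hcont : ∀ σ : ℝ, |σ| ≤ 1 → Continuous fun t : ℝ => f (σ + t * Complex.I) := by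
    intro σ hσ
    refine continuous_iff_continuousAt.2 fun t => ?_
    exact ContinuousAt.comp (f := fun t : ℝ => (σ + t * Complex.I : ℂ)) (g := f)
      (hd _ (by simpa using hσ)).continuousAt (by fun_prop)
  have hint : ∀ σ : ℝ, |σ| ≤ 1 → Integrable fun t : ℝ => f (σ + t * Complex.I) := by
    intro σ hσ
    refine (integrable_inv_one_add_sq.const_mul M).mono' (hcont σ hσ).aestronglyMeasurable ?_
    exact Eventually.of_forall fun t => by simpa using hM (σ + t * Complex.I) (by simpa using hσ)
  have h1 := hint 1 (by simp)
  have h2 := hint (-1) (by simp)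
  have hrect : ∀ T : ℝ, (∫ y : ℝ in -T..T, f ((1 : ℝ) + y * Complex.I)) -
      (∫ y : ℝ in -T..T, f ((-1 : ℝ) + y * Complex.I)) =
      Complex.I * ((∫ x : ℝ in -1..1, f (x + (-T : ℝ) * Complex.I)) -
        ∫ x : ℝ in -1..1, f (x + T * Complex.I)) := by
    intro T
    have := Complex.integral_boundary_rect_eq_zero_of_differentiableOn f ⟨-1, -T⟩ ⟨1, T⟩
      fun z hz => by
        refine (hd z ?_).differentiableWithinAt
        have := (Complex.mem_reProdIm.1 hz).1
        rw [Set.uIcc_of_le (by norm_num)] at this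
        exact abs_le.2 this
    simp only [smul_eq_mul] at this
    linear_combination (-Complex.I) * this + ((∫ y : ℝ in -T..T, f ((1 : ℝ) + y * Complex.I)) -
      (∫ y : ℝ in -T..T, f ((-1 : ℝ) + y * Complex.I))) * Complex.I_mul_I
  have hedge : ∀ T : ℝ, ‖∫ x : ℝ in -1..1, f (x + T * Complex.I)‖ ≤ M * (1 + T ^ 2)⁻¹ * 2 := by
    intro T
    have := intervalIntegral.norm_integral_le_of_norm_le_const (a := -1) (b := 1)
      (f := fun x : ℝ => f (x + T * Complex.I)) (C := M * (1 + T ^ 2)⁻¹) fun x hx => by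
        rw [Set.uIoc_of_le (by norm_num)] at hx
        simpa using hM (x + T * Complex.I) (by simpa using abs_le.2 ⟨hx.1.le, hx.2⟩)
    refine this.trans_eq ?_
    norm_num
  have hzero : Tendsto (fun T : ℝ => M * (1 + T ^ 2)⁻¹ * 2 + M * (1 + T ^ 2)⁻¹ * 2)
      atTop (𝓝 0) := by
    have : Tendsto (fun T : ℝ => (1 + T ^ 2)⁻¹) atTop (𝓝 0) :=
      tendsto_inv_atTop_zero.comp
        (tendsto_atTop_add_const_left _ _ (tendsto_pow_atTop two_ne_zero))
    simpa using ((this.const_mul M).mul_const 2).add ((this.const_mul M).mul_const 2)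
  have hlim := (intervalIntegral_tendsto_integral h1 tendsto_neg_atTop_atBot tendsto_id).sub
    (intervalIntegral_tendsto_integral h2 tendsto_neg_atTop_atBot tendsto_id)
  have hlim0 := squeeze_zero_norm (fun T : ℝ => by
    change ‖(∫ y : ℝ in -T..T, f ((1 : ℝ) + y * Complex.I)) -
      (∫ y : ℝ in -T..T, f ((-1 : ℝ) + y * Complex.I))‖ ≤
      M * (1 + T ^ 2)⁻¹ * 2 + M * (1 + T ^ 2)⁻¹ * 2
    rw [hrect T, norm_mul, Complex.norm_I, one_mul]
    refine (norm_sub_le _ _).trans (add_le_add ?_ (hedge T))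
    simpa only [neg_sq] using hedge (-T)) hzero
  have := tendsto_nhds_unique hlim hlim0
  rw [← integral_sub h1 h2] at this
  push_cast at this h1 h2
  exact ⟨h1.sub h2, this⟩

theorem cos_mul_cos_shift (a t : ℝ) {e : ℂ} (he : e = 1 ∨ e = -1) :
    Complex.cos (Real.pi * (e + t * Complex.I + a) / 2) *
      Complex.cos (Real.pi * (e + t * Complex.I - a) / 2) =
      ((Real.cos (Real.pi * a) - Real.cosh (Real.pi * t)) / 2 : ℝ) := by
  have key : Complex.sin (Real.pi * (t * Complex.I + a) / 2) *
      Complex.sin (Real.pi * (t * Complex.I - a) / 2) =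
      ((Real.cos (Real.pi * a) - Real.cosh (Real.pi * t)) / 2 : ℝ) := by
    push_cast
    rw [← Complex.cos_mul_I, Complex.cos_sub_cos,
      show ((Real.pi * a + Real.pi * t * Complex.I) / 2 : ℂ) =
        Real.pi * (t * Complex.I + a) / 2 by ring,
      show ((Real.pi * a - Real.pi * t * Complex.I) / 2 : ℂ) =
        -(Real.pi * (t * Complex.I - a) / 2) by ring, Complex.sin_neg]
    ring
  rcases he with rfl | rfl
  · rw [← key,
      show (Real.pi * (1 + t * Complex.I + a) / 2 : ℂ) =
        Real.pi * (t * Complex.I + a) / 2 + Real.pi / 2 by ring,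
      show (Real.pi * (1 + t * Complex.I - a) / 2 : ℂ) =
        Real.pi * (t * Complex.I - a) / 2 + Real.pi / 2 by ring,
      Complex.cos_add_pi_div_two, Complex.cos_add_pi_div_two]
    ring
  · rw [← key,
      show (Real.pi * (-1 + t * Complex.I + a) / 2 : ℂ) =
        Real.pi * (t * Complex.I + a) / 2 - Real.pi / 2 by ring,
      show (Real.pi * (-1 + t * Complex.I - a) / 2 : ℂ) =
        Real.pi * (t * Complex.I - a) / 2 - Real.pi / 2 by ring,
      Complex.cos_sub_pi_div_two, Complex.cos_sub_pi_div_two]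

open MeasureTheory in
/-- If `G ≥ 0` on the imaginary axis and `G - 6κ(x² - a²)` is the symmetric difference of a
multiple of `((x-1)² - a²)((x+1)² - a²)`, then `κ < 0`. -/
theorem neg_of_difference_eq (G K : ℂ[X]) {a κ : ℝ} (ha : |a| < 1) (hG : G ≠ 0)
    (hpos : ∀ t : ℝ, ∃ r : ℝ, 0 ≤ r ∧ G.eval (Complex.I * t) = (r : ℂ))
    (hdiff : ∀ z : ℂ,
      K.eval (z + 1) * ((1 - (z + 1 + a) ^ 2) * (1 - (z + 1 - a) ^ 2)) -
      K.eval (z - 1) * ((1 - (z - 1 + a) ^ 2) * (1 - (z - 1 - a) ^ 2)) =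
      G.eval z - 6 * κ * (z ^ 2 - a ^ 2)) : κ < 0 := by
  by_contra! hκ
  obtain ⟨M, hM⟩ := exists_norm_stripKernel_le K ha
  obtain ⟨hint, hzero⟩ := integral_eq_of_differentiableAt_strip
    (fun z hz => differentiableAt_stripKernel K ha hz) hM
  choose g hg0 hg using hpos
  set h : ℝ → ℂ := fun t =>
    stripKernel K a (1 + t * Complex.I) - stripKernel K a (-1 + t * Complex.I) with hh
  have hcosh : ∀ t : ℝ, t ≠ 0 → 0 < Real.cosh (Real.pi * t) - Real.cos (Real.pi * a) := by
    intro t ht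
    have := Real.one_lt_cosh.2 (mul_ne_zero Real.pi_ne_zero ht)
    linarith [Real.cos_le_one (Real.pi * a)]
  have hval : ∀ t : ℝ, t ≠ 0 → h t = ((-(Real.pi ^ 2 / 8 * (g t + 6 * κ * (t ^ 2 + a ^ 2)) /
      (Real.cosh (Real.pi * t) - Real.cos (Real.pi * a))) : ℝ) : ℂ) := by
    intro t ht
    have e1 := stripKernel_mul_cos K a (z := 1 + t * Complex.I) (by simpa using ht)
    have e2 := stripKernel_mul_cos K a (z := -1 + t * Complex.I) (by simpa using ht)
    rw [cos_mul_cos_shift a t (.inl rfl)] at e1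
    rw [cos_mul_cos_shift a t (.inr rfl)] at e2
    have e3 := hdiff (Complex.I * t)
    rw [hg, show Complex.I * t + 1 = 1 + t * Complex.I by ring,
      show Complex.I * t - 1 = -1 + t * Complex.I by ring, mul_pow, Complex.I_sq] at e3
    have hne : ((Real.cosh (Real.pi * t) : ℂ) - Real.cos (Real.pi * a)) ≠ 0 := by
      exact_mod_cast (hcosh t ht).ne'
    rw [Complex.ofReal_neg, Complex.ofReal_div, Complex.ofReal_sub, ← neg_div, eq_div_iff hne]
    simp only [hh]
    push_cast at e1 e2 ⊢
    linear_combination (-2) * e1 + 2 * e2 - Real.pi ^ 2 / 8 * e3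
  have hae : ∀ᵐ t : ℝ, t ≠ 0 := by simp [ae_iff]
  have hnonneg : 0 ≤ᵐ[volume] fun t => -(h t).re := by
    filter_upwards [hae] with t ht
    rw [hval t ht, Complex.ofReal_re, neg_neg]
    have := hcosh t ht
    have := hg0 t
    simp only [Pi.zero_apply]
    positivity
  have hint0 : ∫ t, -(h t).re = 0 := by
    rw [integral_neg]
    have : ∫ t, (h t).re = (∫ t, h t).re := integral_re hint
    rw [this, hzero]; simp
  have hz := (integral_eq_zero_iff_of_nonneg_ae hnonneg hint.re.neg).1 hint0
  have hfin : {t : ℝ | G.eval (Complex.I * t) = 0}.Finite := by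
    have hinj : Function.Injective fun t : ℝ => Complex.I * (t : ℂ) := fun s t hst => by
      simpa using hst
    exact (Polynomial.finite_setOfPred_isRoot hG).preimage hinj.injOn
  have hmem : ∀ᵐ t : ℝ, t ∈ {t : ℝ | G.eval (Complex.I * t) = 0} := by
    filter_upwards [hz, hae] with t h0 ht
    rw [hval t ht, Complex.ofReal_re, neg_neg] at h0
    have hc := hcosh t ht
    have hπ := Real.pi_pos
    have h1 : 0 ≤ 6 * κ * (t ^ 2 + a ^ 2) := by positivity
    simp only [Pi.zero_apply, div_eq_zero_iff, mul_eq_zero, hc.ne', or_false] at h0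
    have h2 : g t = 0 := by
      rcases h0 with h0 | h0
      · exfalso; have : 0 < Real.pi ^ 2 / 8 := by positivity
        simp [hπ.ne'] at h0
      · linarith [hg0 t]
    change G.eval _ = 0
    rw [hg, h2, Complex.ofReal_zero]
  have hfull : volume (Set.univ : Set ℝ) = 0 := by
    rw [← Set.union_compl_self {t : ℝ | G.eval (Complex.I * t) = 0}]
    exact measure_union_null (hfin.measure_zero _) (mem_ae_iff.1 hmem)
  simp at hfull

theorem neg_of_dvd (G S : ℂ[X]) {a κ : ℝ} {c : ℂ} (ha : |a| < 1) (hG : G ≠ 0)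
    (hpos : ∀ t : ℝ, ∃ r : ℝ, 0 ≤ r ∧ G.eval (Complex.I * t) = (r : ℂ))
    (hS : ∀ z : ℂ, S.eval (z + 1) - S.eval (z - 1) = -(G.eval (z + 1) + G.eval (z - 1)) / 2)
    (hGdvd : (X - C (a : ℂ)) * (X - C (-a : ℂ)) ∣ G)
    (hSdvd : (X - C (a : ℂ)) * (X - C (-a : ℂ)) ∣ S + C c + C (2 * κ * (1 - a ^ 2) : ℂ) * X) :
    κ < 0 := by
  obtain ⟨H, hH⟩ := hGdvd
  obtain ⟨Q, hQ⟩ := hSdvd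
  have hGe : ∀ z, G.eval z = (z - a) * (z + a) * H.eval z := fun z => by rw [hH]; simp
  have hSe : ∀ z, S.eval z = (z - a) * (z + a) * Q.eval z - c - 2 * κ * (1 - a ^ 2) * z :=
    fun z => by
      have := congrArg (eval z) hQ
      simp only [eval_add, eval_mul, eval_sub, eval_X, eval_C] at this
      linear_combination this
  set U : ℂ[X] := C (1 / 2) * H - Q - C (κ : ℂ) * (X + 3) with hU
  set p : ℂ[X] := (X - 1) ^ 2 - C (a ^ 2 : ℂ) with hp
  set q : ℂ[X] := (X + 1) ^ 2 - C (a ^ 2 : ℂ) with hq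
  have ha2 : (1 - a ^ 2 : ℂ) ≠ 0 := by
    have : a ^ 2 < 1 := by rw [← sq_abs]; exact pow_lt_one₀ (abs_nonneg a) ha two_ne_zero
    exact_mod_cast (by linarith : 0 < 1 - a ^ 2).ne'
  have hcop : IsCoprime p q := by
    refine ⟨C (1 / (2 * (1 - a ^ 2)) : ℂ) * (1 + C (1 / 2) * X),
      C (1 / (2 * (1 - a ^ 2)) : ℂ) * (1 - C (1 / 2) * X), Polynomial.funext fun z => ?_⟩
    simp only [hp, hq, eval_add, eval_mul, eval_sub, eval_X, eval_C, eval_one, eval_pow]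
    field_simp
    ring
  have hW : p * U.comp (X - 1) = q * (U - H + C (6 * κ : ℂ)).comp (X + 1) := by
    refine Polynomial.funext fun z => ?_
    have h1 := hS z
    rw [hGe, hGe, hSe, hSe] at h1
    simp only [hp, hq, hU, eval_add, eval_mul, eval_sub, eval_X, eval_C, eval_one, eval_pow,
      eval_comp, eval_ofNat]
    linear_combination h1
  obtain ⟨K, hK⟩ := hcop.mul_dvd (Dvd.intro _ rfl) (Dvd.intro _ hW.symm)
  refine neg_of_difference_eq G K ha hG hpos fun z => ?_
  have h1 := congrArg (eval (z + 1)) hK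
  have h2 := congrArg (eval (z - 1)) hK
  have h3 := congrArg (eval (z - 1)) hW
  simp only [hp, hq, eval_add, eval_mul, eval_sub, eval_X, eval_C, eval_one, eval_pow,
    eval_comp, add_sub_cancel_right, sub_add_cancel] at h1 h2 h3
  rw [hGe]
  linear_combination h2 - h1 - h3

theorem eval_pconj (F : ℂ[X]) (z : ℂ) :
    (pconj F).eval z = starRingEnd ℂ (F.eval (-starRingEnd ℂ z)) := by
  have := eval_map_apply (p := F) (f := starRingEnd ℂ) (-starRingEnd ℂ z)
  rw [pconj, eval_comp]
  simpa using this

theorem pconj_eq_self {G : ℂ[X]} (h : ∀ t : ℝ, ∃ r : ℝ, G.eval (Complex.I * t) = (r : ℂ)) :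
    pconj G = G := by
  refine eq_of_infinite_eval_eq _ _ (Set.Infinite.mono ?_ (Set.infinite_range_of_injective
    (f := fun t : ℝ => Complex.I * (t : ℂ)) fun s t hst => by simpa using hst))
  rintro _ ⟨t, rfl⟩
  obtain ⟨r, hr⟩ := h t
  have : -starRingEnd ℂ (Complex.I * t) = Complex.I * t := by simp
  change (pconj G).eval (Complex.I * t) = G.eval (Complex.I * t)
  rw [eval_pconj, this, hr, Complex.conj_ofReal]

theorem eval_derivative_pconj (F : ℂ[X]) :
    (pconj F).derivative.eval 0 = -starRingEnd ℂ (F.derivative.eval 0) := by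
  rw [pconj, derivative_comp, derivative_map]
  simp

theorem deriv_eval_eq_zero {G : ℂ[X]}
    (hpos : ∀ t : ℝ, ∃ r : ℝ, 0 ≤ r ∧ G.eval (Complex.I * t) = (r : ℂ)) (h0 : G.eval 0 = 0) :
    G.derivative.eval 0 = 0 := by
  have hre : (G.derivative.eval 0).re = 0 := by
    have h1 := eval_derivative_pconj G
    rw [pconj_eq_self fun t => (hpos t).imp fun r hr => hr.2] at h1
    have := congrArg Complex.re h1
    simp at this
    linarith
  have hderiv : HasDerivAt (fun t : ℝ => (G.eval (Complex.I * t)).re)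
      (G.derivative.eval 0 * Complex.I).re 0 := by
    have h1 : HasDerivAt (fun z : ℂ => G.eval (Complex.I * z)) (G.derivative.eval 0 * Complex.I)
        ((0 : ℝ) : ℂ) := by
      have h2 : HasDerivAt (fun z : ℂ => Complex.I * z) Complex.I ((0 : ℝ) : ℂ) := by
        simpa using (hasDerivAt_id ((0 : ℝ) : ℂ)).const_mul Complex.I
      have h3 := G.hasDerivAt (Complex.I * ((0 : ℝ) : ℂ))
      have h4 := h3.comp _ h2
      simpa [Function.comp_def] using h4
    exact h1.real_of_complex
  have hmin : IsLocalMin (fun t : ℝ => (G.eval (Complex.I * t)).re) 0 := by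
    refine Filter.Eventually.of_forall fun t => ?_
    obtain ⟨r, hr, h⟩ := hpos t
    simp [h, h0, hr]
  have him := hmin.hasDerivAt_eq_zero hderiv
  simp at him
  exact Complex.ext hre him

theorem quadratic_dvd_of_ne_zero {p : ℂ[X]} {b : ℂ} (hb : b ≠ 0) (h1 : p.eval b = 0)
    (h2 : p.eval (-b) = 0) : (X - C b) * (X - C (-b)) ∣ p := by
  refine IsCoprime.mul_dvd (isCoprime_X_sub_C_of_isUnit_sub ?_) (dvd_iff_isRoot.2 h1)
    (dvd_iff_isRoot.2 h2)
  rw [isUnit_iff_ne_zero, sub_neg_eq_add, ← two_mul]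
  exact mul_ne_zero two_ne_zero hb

theorem X_sq_dvd_of_eval {p : ℂ[X]} (h1 : p.eval 0 = 0) (h2 : p.derivative.eval 0 = 0) :
    X ^ 2 ∣ p := by
  rw [X_pow_dvd_iff]
  intro d hd
  rw [← coeff_zero_eq_eval_zero] at h1 h2
  rw [coeff_derivative] at h2
  interval_cases d
  · exact h1
  · simpa using h2

/-- let `P ≠ 0` be nonnegative on the imaginary axis with a real root
`α ∈ (−1, 0]`, let `R ≠ 0`, set `F(x) = −Re₀(R̄(1−x)R(x−1)P(x−1))`, and let `S` satisfy
`S(x+1) − S(x−1) = F(x)` and `S̄(−x) = −S(x)`. Then `S(−α) − S(α) > 0` if `α ∈ (−1, 0)`,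
and `S'(0) > 0` if `α = 0` (both values being real). -/
theorem stmt14 (P R S F : ℂ[X]) (hP : P ≠ 0)
    (hPpos : ∀ t : ℝ, ∃ r : ℝ, 0 ≤ r ∧ P.eval (Complex.I * t) = (r : ℂ))
    (α : ℝ) (hα1 : -1 < α) (hα2 : α ≤ 0) (hroot : P.eval (α : ℂ) = 0)
    (hR : R ≠ 0)
    (hF : F = -re0 ((R * pconj R * P).comp (X - 1)))
    (hS : S.comp (X + 1) - S.comp (X - 1) = F)
    (hSodd : pconj S = -S) :
    (α < 0 → ∃ r : ℝ, 0 < r ∧ S.eval (-(α : ℂ)) - S.eval (α : ℂ) = (r : ℂ)) ∧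
    (α = 0 → ∃ r : ℝ, 0 < r ∧ S.derivative.eval 0 = (r : ℂ)) := by
  have hI : ∀ t : ℝ, -starRingEnd ℂ (Complex.I * t) = Complex.I * t := fun t => by simp
  obtain ⟨G, hGdef⟩ : ∃ G, G = R * pconj R * P := ⟨_, rfl⟩
  rw [← hGdef] at hF
  have hpc : pconj R ≠ 0 := by
    intro h
    refine hR (Polynomial.funext fun z => ?_)
    have := eval_pconj R (-starRingEnd ℂ z)
    rw [h] at this
    simpa using this.symm
  have hG : G ≠ 0 := hGdef ▸ mul_ne_zero (mul_ne_zero hR hpc) hP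
  have hpos : ∀ t : ℝ, ∃ r : ℝ, 0 ≤ r ∧ G.eval (Complex.I * t) = (r : ℂ) := by
    intro t
    obtain ⟨r, hr, h⟩ := hPpos t
    refine ⟨Complex.normSq (R.eval (Complex.I * t)) * r,
      mul_nonneg (Complex.normSq_nonneg _) hr, ?_⟩
    rw [hGdef, eval_mul, eval_mul, eval_pconj, hI, h, Complex.mul_conj]
    push_cast
    rfl
  have hsymm : pconj G = G := pconj_eq_self fun t => (hpos t).imp fun r hr => hr.2
  have hconj : ∀ z, G.eval z = starRingEnd ℂ (G.eval (-starRingEnd ℂ z)) := fun z => by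
    rw [← eval_pconj, hsymm]
  have hGα : G.eval (α : ℂ) = 0 := by rw [hGdef, eval_mul, hroot, mul_zero]
  have hGα' : G.eval (-α : ℂ) = 0 := by rw [hconj]; simp [hGα]
  have hSe : ∀ z : ℂ,
      S.eval (z + 1) - S.eval (z - 1) = -(G.eval (z + 1) + G.eval (z - 1)) / 2 := by
    intro z
    have h1 := congrArg (eval z) hS
    have h2 : (pconj (G.comp (X - 1))).eval z = G.eval (z + 1) := by
      rw [eval_pconj, hconj (z + 1), eval_comp]
      congr 2
      simp
      ring
    rw [hF, eval_neg, re0, eval_smul, eval_add, h2] at h1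
    simp only [eval_sub, eval_add, eval_comp, eval_X, eval_one, smul_eq_mul] at h1
    linear_combination h1
  have hα : |α| < 1 := abs_lt.2 ⟨hα1, by linarith⟩
  refine ⟨fun hneg => ?_, fun hzero => ?_⟩
  · have h1 := eval_pconj S (α : ℂ)
    rw [hSodd, eval_neg, Complex.conj_ofReal] at h1
    set r : ℝ := 2 * (S.eval (-α : ℂ)).re with hr
    have hreal : S.eval (-α : ℂ) - S.eval (α : ℂ) = (r : ℂ) := by
      rw [sub_eq_add_neg, h1, Complex.add_conj]
    refine ⟨r, ?_, hreal⟩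
    have hα0 : (α : ℂ) ≠ 0 := by exact_mod_cast hneg.ne
    have hq : 0 < 1 - α ^ 2 := by nlinarith
    have hq0 : (1 - α ^ 2 : ℂ) ≠ 0 := by exact_mod_cast hq.ne'
    have hκ : r / (4 * α * (1 - α ^ 2)) < 0 := by
      refine neg_of_dvd G S (c := -(S.eval (α : ℂ) + S.eval (-α : ℂ)) / 2) hα hG hpos hSe
        (quadratic_dvd_of_ne_zero hα0 hGα hGα') (quadratic_dvd_of_ne_zero hα0 ?_ ?_)
      all_goals
        simp only [eval_add, eval_mul, eval_C, eval_X]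
        push_cast
        rw [← hreal]
        field_simp
        ring
    have hden : 4 * α * (1 - α ^ 2) < 0 := mul_neg_of_neg_of_pos (by linarith) hq
    by_contra! hle
    exact absurd hκ (not_lt.2 (div_nonneg_of_nonpos hle hden.le))
  · subst hzero
    have h1 := eval_derivative_pconj S
    rw [hSodd, derivative_neg, eval_neg, neg_inj] at h1
    obtain ⟨r, hr⟩ := Complex.conj_eq_iff_real.1 h1.symm
    refine ⟨r, ?_, hr⟩
    have hX : (X - C ((0 : ℝ) : ℂ)) * (X - C (-(0 : ℝ) : ℂ)) = (X ^ 2 : ℂ[X]) := by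
      simp [sq]
    rw [Complex.ofReal_zero] at hGα
    have hκ : -r / 2 < 0 := by
      refine neg_of_dvd G S (c := -S.eval 0) hα hG hpos hSe ?_ ?_ <;> rw [hX]
      · exact X_sq_dvd_of_eval hGα (deriv_eval_eq_zero hpos hGα)
      · refine X_sq_dvd_of_eval ?_ ?_
        · simp
        · simp [hr]
          ring
    linarith

end
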